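/- arXiv:1501.04056 — 2 statements merged into one kernel-verified Lean document; each statement's English description precedes it below -/
import Mathlib

section
/- Let λ > 0, k_c > 0, γ > 0, and let n_ψ ≤ q be positive integers with nonnegative coefficients α₁,…,α_{n_ψ}. Let d ≥ 0, g ≥ k_c·d, and ψ ≥ 0 be real numbers with ψ ≤ Σ_{i=1}^{n_ψ} α_i d^i. If √γ·α_i ≤ (λ·k_c)^i / (2·λ·(i−1)!) for every i ∈ {1,…,n_ψ}, then γ·ψ² − ([Σ_{i=1}^{q} (λ·g)^{i−1}/(i−1)!]·g)² ≤ −(3/4)·(Σ_{i=1}^{n_ψ} (λ·k_c)^i·d^i/(λ·(i−1)!))². -/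
/-- A sum over `1 ≤ i ≤ n` whose terms are degree-`i` monomials in `a * d` is a truncated
exponential series times `a * d`. -/
theorem sum_Icc_pow_div_factorial_eq (lam a d : ℝ) (hlam : lam ≠ 0) (n : ℕ) :
    ∑ i ∈ Finset.Icc 1 n, (lam * a) ^ i * d ^ i / (lam * (Nat.factorial (i - 1) : ℝ)) =
      (∑ j ∈ Finset.range n, (lam * (a * d)) ^ j / (Nat.factorial j : ℝ)) * (a * d) := by
  induction n with
  | zero => simp
  | succ n ih =>
    rw [Finset.sum_Icc_succ_top (by omega), ih, Finset.sum_range_succ, add_mul,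
      Nat.add_sub_cancel]
    have hn : (Nat.factorial n : ℝ) ≠ 0 := by positivity
    congr 1
    field_simp
    ring

/-- Truncated exponential series times their argument are monotone in the argument and in the
truncation order. -/
theorem sum_range_pow_div_factorial_mul_le {lam x y : ℝ} (hlam : 0 ≤ lam) (hx : 0 ≤ x)
    (hxy : x ≤ y) {m n : ℕ} (hmn : m ≤ n) :
    (∑ j ∈ Finset.range m, (lam * x) ^ j / (Nat.factorial j : ℝ)) * x ≤
      (∑ j ∈ Finset.range n, (lam * y) ^ j / (Nat.factorial j : ℝ)) * y := by
  have hy : 0 ≤ y := hx.trans hxy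
  refine mul_le_mul ?_ hxy hx (Finset.sum_nonneg fun j _ => by positivity)
  calc ∑ j ∈ Finset.range m, (lam * x) ^ j / (Nat.factorial j : ℝ)
      ≤ ∑ j ∈ Finset.range m, (lam * y) ^ j / (Nat.factorial j : ℝ) := by gcongr
    _ ≤ ∑ j ∈ Finset.range n, (lam * y) ^ j / (Nat.factorial j : ℝ) :=
      Finset.sum_le_sum_of_subset_of_nonneg (Finset.range_mono hmn)
        fun j _ _ => by positivity

/-- the key algebraic descent estimate. Here `g` plays the role of the gradient
norm, `d` the distance to the stationary set, `ψ` the penalty value, and the condition on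
`√γ` is the sufficient smallness condition on the weight dynamics gain `γ`. -/
theorem descent_estimate (lam kc γ : ℝ) (hlam : 0 < lam) (hkc : 0 < kc) (hγ : 0 < γ)
    (nψ q : ℕ) (hnψ : 0 < nψ) (hq : nψ ≤ q)
    (α : ℕ → ℝ) (hα : ∀ i, 0 ≤ α i)
    (d g ψ : ℝ) (hd : 0 ≤ d) (hg : kc * d ≤ g) (hψ0 : 0 ≤ ψ)
    (hψ : ψ ≤ ∑ i ∈ Finset.Icc 1 nψ, α i * d ^ i)
    (hsmall : ∀ i ∈ Finset.Icc 1 nψ,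
      Real.sqrt γ * α i ≤ (lam * kc) ^ i / (2 * lam * (Nat.factorial (i - 1) : ℝ))) :
    γ * ψ ^ 2 -
        ((∑ j ∈ Finset.range q, (lam * g) ^ j / (Nat.factorial j : ℝ)) * g) ^ 2 ≤
      -(3 / 4) *
        (∑ i ∈ Finset.Icc 1 nψ, (lam * kc) ^ i * d ^ i / (lam * (Nat.factorial (i - 1) : ℝ))) ^ 2 := by
  have hdescent := sum_range_pow_div_factorial_mul_le hlam.le (mul_nonneg hkc.le hd) hg hq
  rw [← sum_Icc_pow_div_factorial_eq lam kc d hlam.ne' nψ] at hdescent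
  set S := ∑ i ∈ Finset.Icc 1 nψ,
    (lam * kc) ^ i * d ^ i / (lam * (Nat.factorial (i - 1) : ℝ)) with hS
  have hS0 : 0 ≤ S := Finset.sum_nonneg fun i _ => by positivity
  have hpenalty : √γ * ψ ≤ S / 2 := by
    calc √γ * ψ ≤ √γ * ∑ i ∈ Finset.Icc 1 nψ, α i * d ^ i := by gcongr
      _ = ∑ i ∈ Finset.Icc 1 nψ, √γ * α i * d ^ i := by
        simp only [Finset.mul_sum, mul_assoc]
      _ ≤ ∑ i ∈ Finset.Icc 1 nψ,
          (lam * kc) ^ i / (2 * lam * (Nat.factorial (i - 1) : ℝ)) * d ^ i :=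
        Finset.sum_le_sum fun i hi =>
          mul_le_mul_of_nonneg_right (hsmall i hi) (pow_nonneg hd i)
      _ = S / 2 := by
        rw [hS, Finset.sum_div]
        refine Finset.sum_congr rfl fun i _ => ?_
        field_simp
  have hψsq : γ * ψ ^ 2 ≤ (S / 2) ^ 2 := by
    calc γ * ψ ^ 2 = (√γ * ψ) ^ 2 := by rw [mul_pow, Real.sq_sqrt hγ.le]
      _ ≤ (S / 2) ^ 2 := by gcongr
  have hSsq := pow_le_pow_left₀ hS0 hdescent 2
  linarith
end

section
/- Let f : ℝⁿ → ℝ and c₁,…,c_{n_c} : ℝⁿ → ℝ be continuously differentiable, let m ≥ 2 be an integer, and define ψ(x) = Σ_{i=1}^{n_c} (max{0, c_i(x)})^m and f̄(x,ρ) = f(x) + ρ·ψ(x). Let x : [0,∞) → ℝⁿ and ρ : [0,∞) → ℝ be functions such that ψ(x(t)) → 0 and ‖∇_x f̄(x(t),ρ(t))‖ → 0 as t → ∞. If there exist a sequence t_k → ∞ and a point (x*, ρ*) ∈ ℝⁿ × ℝ with x(t_k) → x* and ρ(t_k) → ρ*, then ψ(x*) = 0, ∇_x f̄(x*,ρ*)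 = 0, and x* satisfies the KKT conditions for the problem min f(x) subject to c_i(x) ≤ 0. -/
open Filter Topology

/-- The exact penalty term `ψ(x) = Σ_{i=1}^{n_c} (max{0, c_i(x)})^m`. -/
noncomputable def psiP {n nc : ℕ} (c : Fin nc → EuclideanSpace ℝ (Fin n) → ℝ) (m : ℕ)
    (x : EuclideanSpace ℝ (Fin n)) : ℝ :=
  ∑ i, max 0 (c i x) ^ m

/-- The weighted cost `f̄(x,ρ) = f(x) + ρ·ψ(x)`. -/
noncomputable def fbarP {n nc : ℕ} (f : EuclideanSpace ℝ (Fin n) → ℝ)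
    (c : Fin nc → EuclideanSpace ℝ (Fin n) → ℝ) (m : ℕ) (ρ : ℝ)
    (x : EuclideanSpace ℝ (Fin n)) : ℝ :=
  f x + ρ * psiP c m x

/-- The gradient norm `g(x,ρ) = ‖∇_x f̄(x,ρ)‖`. -/
noncomputable def gP {n nc : ℕ} (f : EuclideanSpace ℝ (Fin n) → ℝ)
    (c : Fin nc → EuclideanSpace ℝ (Fin n) → ℝ) (m : ℕ) (ρ : ℝ)
    (x : EuclideanSpace ℝ (Fin n)) : ℝ :=
  ‖gradient (fbarP f c m ρ) x‖

/-- The stationary set `S_ρ = {x | ∇_x f̄(x,ρ) = 0}`. -/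
def SP {n nc : ℕ} (f : EuclideanSpace ℝ (Fin n) → ℝ)
    (c : Fin nc → EuclideanSpace ℝ (Fin n) → ℝ) (m : ℕ) (ρ : ℝ) :
    Set (EuclideanSpace ℝ (Fin n)) :=
  {x | gradient (fbarP f c m ρ) x = 0}

/-- The distance `d(x,ρ)` from `x` to the stationary set `S_ρ`. -/
noncomputable def dP {n nc : ℕ} (f : EuclideanSpace ℝ (Fin n) → ℝ)
    (c : Fin nc → EuclideanSpace ℝ (Fin n) → ℝ) (m : ℕ) (ρ : ℝ)
    (x : EuclideanSpace ℝ (Fin n)) : ℝ :=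
  Metric.infDist x (SP f c m ρ)

/-- `x` satisfies the KKT conditions for `min f` s.t. `c_i ≤ 0`. -/
def KKT {n nc : ℕ} (f : EuclideanSpace ℝ (Fin n) → ℝ)
    (c : Fin nc → EuclideanSpace ℝ (Fin n) → ℝ)
    (x : EuclideanSpace ℝ (Fin n)) : Prop :=
  ∃ μ : Fin nc → ℝ, (∀ i, 0 ≤ μ i) ∧
    gradient f x + ∑ i, μ i • gradient (c i) x = 0 ∧
    (∀ i, c i x ≤ 0) ∧
    (∀ i, μ i * c i x = 0)

/-- For `m ≥ 2` the function `s ↦ max 0 s ^ m` is differentiable on the whole line. -/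
theorem hasDerivAt_max_zero_pow {m : ℕ} (hm : 2 ≤ m) (s : ℝ) :
    HasDerivAt (fun s : ℝ => max 0 s ^ m) (m * max 0 s ^ (m - 1)) s := by
  rcases lt_trichotomy s 0 with hs | rfl | hs
  · have h : (fun s : ℝ => max 0 s ^ m) =ᶠ[𝓝 s] fun _ => 0 := by
      filter_upwards [Iio_mem_nhds hs] with y hy
      rw [max_eq_left (le_of_lt hy), zero_pow (by omega)]
    rw [max_eq_left hs.le, zero_pow (by omega), mul_zero]
    exact (hasDerivAt_const s (0 : ℝ)).congr_of_eventuallyEq h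
  · rw [max_self, zero_pow (by omega), mul_zero, hasDerivAt_iff_isLittleO]
    refine Asymptotics.IsBigO.trans_isLittleO (g := fun y : ℝ => y ^ m)
      (Asymptotics.isBigO_of_le _ fun y => ?_) ?_
    · simp only [max_self, smul_zero, sub_zero, zero_pow (show m ≠ 0 by omega), norm_pow,
        Real.norm_eq_abs]
      refine pow_le_pow_left₀ (abs_nonneg _) ?_ m
      rw [abs_of_nonneg (le_max_left (0 : ℝ) y)]
      exact max_le (abs_nonneg y) (le_abs_self y)
    · simpa using Asymptotics.isLittleO_pow_id (𝕜 := ℝ) (show 1 < m by omega)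
  · have h : (fun s : ℝ => max 0 s ^ m) =ᶠ[𝓝 s] fun y => y ^ m := by
      filter_upwards [Ioi_mem_nhds hs] with y hy
      rw [max_eq_right (le_of_lt hy)]
    rw [max_eq_right hs.le]
    exact (hasDerivAt_pow m s).congr_of_eventuallyEq h

/-- The gradient of the weighted cost. -/
theorem gradient_fbarP {n nc : ℕ} {f : EuclideanSpace ℝ (Fin n) → ℝ}
    {c : Fin nc → EuclideanSpace ℝ (Fin n) → ℝ} {m : ℕ} (hm : 2 ≤ m) (ρ : ℝ)
    {x : EuclideanSpace ℝ (Fin n)} (hf : DifferentiableAt ℝ f x)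
    (hc : ∀ i, DifferentiableAt ℝ (c i) x) :
    gradient (fbarP f c m ρ) x =
      gradient f x + ρ • ∑ i, ((m : ℝ) * max 0 (c i x) ^ (m - 1)) • gradient (c i) x := by
  have hψ : HasFDerivAt (psiP c m)
      (∑ i, ((m : ℝ) * max 0 (c i x) ^ (m - 1)) • fderiv ℝ (c i) x) x :=
    HasFDerivAt.fun_sum fun i _ =>
      (hasDerivAt_max_zero_pow hm (c i x)).comp_hasFDerivAt x (hc i).hasFDerivAt
  have h : HasFDerivAt (fbarP f c m ρ) (fderiv ℝ f x +
      ρ • ∑ i, ((m : ℝ) * max 0 (c i x) ^ (m - 1)) • fderiv ℝ (c i) x) x :=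
    hf.hasFDerivAt.add (hψ.const_mul ρ)
  simp [gradient, h.fderiv]

theorem ContDiff.continuous_gradient_real {E : Type*} [NormedAddCommGroup E]
    [InnerProductSpace ℝ E] [CompleteSpace E] {f : E → ℝ} (hf : ContDiff ℝ 1 f) :
    Continuous (gradient f) :=
  (InnerProductSpace.toDual ℝ E).symm.continuous.comp (hf.continuous_fderiv one_ne_zero)

theorem psiP_eq_zero_iff {n nc : ℕ} {c : Fin nc → EuclideanSpace ℝ (Fin n) → ℝ} {m : ℕ}
    (hm : m ≠ 0) {x : EuclideanSpace ℝ (Fin n)} : psiP c m x = 0 ↔ ∀ i, c i x ≤ 0 := by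
  rw [psiP, Finset.sum_eq_zero_iff_of_nonneg fun i _ => pow_nonneg (le_max_left 0 _) m]
  simp [hm]

/-- if along a trajectory `ψ(x(t)) → 0` and `‖∇_x f̄(x(t),ρ(t))‖ → 0`, then
any limit point `(x*,ρ*)` of the trajectory satisfies `ψ(x*) = 0`, `∇_x f̄(x*,ρ*) = 0`,
and `x*` is a KKT point of the constrained problem. -/
theorem limit_point_is_KKT (n nc : ℕ) (hn : 0 < n) (hnc : 0 < nc)
    (f : EuclideanSpace ℝ (Fin n) → ℝ) (c : Fin nc → EuclideanSpace ℝ (Fin n) → ℝ)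
    (hf : ContDiff ℝ 1 f) (hc : ∀ i, ContDiff ℝ 1 (c i))
    (m : ℕ) (hm : 2 ≤ m)
    (x : ℝ → EuclideanSpace ℝ (Fin n)) (ρ : ℝ → ℝ)
    (hψ : Tendsto (fun t => psiP c m (x t)) atTop (𝓝 0))
    (hg : Tendsto (fun t => ‖gradient (fbarP f c m (ρ t)) (x t)‖) atTop (𝓝 0))
    (tk : ℕ → ℝ) (htk : Tendsto tk atTop atTop)
    (xs : EuclideanSpace ℝ (Fin n)) (ρs : ℝ)
    (hxs : Tendsto (fun k => x (tk k)) atTop (𝓝 xs))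
    (hρs : Tendsto (fun k => ρ (tk k)) atTop (𝓝 ρs)) :
    psiP c m xs = 0 ∧ gradient (fbarP f c m ρs) xs = 0 ∧ KKT f c xs := by
  have hx : Tendsto (fun k => psiP c m (x (tk k))) atTop (𝓝 (psiP c m xs)) := by
    have hcont : Continuous (psiP c m) :=
      continuous_finsetSum _ fun i _ => (continuous_const.max (hc i).continuous).pow m
    exact (hcont.tendsto xs).comp hxs
  have hψs : psiP c m xs = 0 := tendsto_nhds_unique hx (hψ.comp htk)
  have hle : ∀ i, c i xs ≤ 0 := (psiP_eq_zero_iff (by omega)).1 hψs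
  have hgrad (r : ℝ) (y : EuclideanSpace ℝ (Fin n)) := gradient_fbarP (f := f) (c := c) hm r
    (x := y) (hf.differentiable one_ne_zero y) fun i => (hc i).differentiable one_ne_zero y
  have hcont : Continuous fun p : ℝ × EuclideanSpace ℝ (Fin n) =>
      gradient (fbarP f c m p.1) p.2 := by
    simp only [hgrad]
    have hf' := hf.continuous_gradient_real
    have hc' := fun i => (hc i).continuous_gradient_real
    have hc₀ := fun i => (hc i).continuous
    fun_prop
  have hlim : Tendsto (fun k => gradient (fbarP f c m (ρ (tk k))) (x (tk k))) atTop
      (𝓝 (gradient (fbarP f c m ρs) xs)) := by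
    have h := (hcont.tendsto (ρs, xs)).comp (hρs.prodMk_nhds hxs)
    simpa only [Function.comp_def] using h
  have hstat : gradient (fbarP f c m ρs) xs = 0 :=
    tendsto_nhds_unique hlim (tendsto_zero_iff_norm_tendsto_zero.2 (hg.comp htk))
  refine ⟨hψs, hstat, fun _ => 0, fun _ => le_rfl, ?_, hle, fun _ => zero_mul _⟩
  have h0 : ∀ i, max 0 (c i xs) ^ (m - 1) = 0 := fun i => by
    rw [max_eq_left (hle i), zero_pow (by omega)]
  simpa [hgrad, h0] using hstat
end
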